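/- Let n ≥ 3, let α, β, γ, ν, μ be real numbers and 1 < p ≤ q < ∞, and assume ν/p′ + μ/q > 0. If the operator S = S_{α,β,γ} is bounded from L^p_ν(Λ_n) into L^q_μ(Λ_n), then the parameters satisfy: (i) γ = α + β + n/2 − ν/p + μ/q; (ii) p(β − γ + n − 1) − n/2 + 1 < ν < p(β + 1) + n/2 − 1; (iii) n/2 − 1 − qα < μ < q(γ − α) − n/2 + 1. (This is the necessity lemma, Lemma 4.4 of the paper, instantiated on the rank-2 Lorentz cone, where n/r = n/2 and 2(n/r) − 1 = n − 1.) -/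

import Mathlib

open MeasureTheory ENNReal

noncomputable section

/-- The Lorentz determinant `Δ(y) = y₁² − y₂² − ⋯ − y_n²`. -/
def lDelta (n : ℕ) [NeZero n] (y : Fin n → ℝ) : ℝ :=
  2 * y 0 ^ 2 - ∑ i, y i ^ 2

/-- The Lorentz cone `Λ_n`. -/
def lCone (n : ℕ) [NeZero n] : Set (Fin n → ℝ) :=
  {y | 0 < lDelta n y ∧ 0 < y 0}

/-- The `L^p_ν(Λ_n)` norm `(∫_{Λ_n} |g(y)|^p Δ(y)^{ν−n/2} dy)^{1/p}`. -/
def coneNorm (n : ℕ) [NeZero n] (p ν : ℝ) (g : (Fin n → ℝ) → ℝ) : ℝ≥0∞ :=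
  (∫⁻ y in lCone n, ENNReal.ofReal (|g y| ^ p * lDelta n y ^ (ν - (n : ℝ) / 2))) ^ (1 / p)

/-- The operator `S_{α,β,γ}` applied to `|g|`:
`S|g|(y) = Δ(y)^α ∫_{Λ_n} Δ(y+x)^{−γ} |g(x)| Δ(x)^β dx`. -/
def Sop (n : ℕ) [NeZero n] (α β γ : ℝ) (g : (Fin n → ℝ) → ℝ) (y : Fin n → ℝ) : ℝ≥0∞ :=
  ENNReal.ofReal (lDelta n y ^ α) *
    ∫⁻ x in lCone n, ENNReal.ofReal (lDelta n (y + x) ^ (-γ) * |g x| * lDelta n x ^ β)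

/-- The `L^q_μ(Λ_n)` norm of `S_{α,β,γ}|g|`. -/
def SopNorm (n : ℕ) [NeZero n] (α β γ q μ : ℝ) (g : (Fin n → ℝ) → ℝ) : ℝ≥0∞ :=
  (∫⁻ y in lCone n, Sop n α β γ g y ^ q * ENNReal.ofReal (lDelta n y ^ (μ - (n : ℝ) / 2))) ^ (1 / q)

/-- `S_{α,β,γ}` is bounded from `L^p_ν(Λ_n)` to `L^q_μ(Λ_n)`:
`‖S|g|‖_{q,μ} ≤ C ‖g‖_{p,ν}` for every `g ∈ L^p_ν(Λ_n)`. -/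
def SBounded (n : ℕ) [NeZero n] (α β γ p ν q μ : ℝ) : Prop :=
  ∃ C > (0 : ℝ), ∀ g : (Fin n → ℝ) → ℝ, Measurable g → coneNorm n p ν g < ⊤ →
    SopNorm n α β γ q μ g ≤ ENNReal.ofReal C * coneNorm n p ν g

/-- The identity element `(1, 0, …, 0)` of the Lorentz cone. -/
def lUnit (n : ℕ) [NeZero n] : Fin n → ℝ := Pi.single 0 1

lemma lDelta_smul (n : ℕ) [NeZero n] (r : ℝ) (x : Fin n → ℝ) :
    lDelta n (r • x) = r ^ 2 * lDelta n x := by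
  simp only [lDelta, Pi.smul_apply, smul_eq_mul, mul_pow, ← Finset.mul_sum]
  ring

lemma lDelta_add_smul_lUnit (n : ℕ) [NeZero n] (x : Fin n → ℝ) (c : ℝ) :
    lDelta n (x + c • lUnit n) = lDelta n x + 2 * c * x 0 + c ^ 2 := by
  have h : ∀ i, (x i + c * lUnit n i) ^ 2
      = x i ^ 2 + (if i = 0 then 2 * c * x 0 + c ^ 2 else 0) := by
    intro i
    by_cases hi : i = 0
    · subst hi; simp [lUnit]; ring
    · simp [lUnit, hi]
  simp only [lDelta, Pi.add_apply, Pi.smul_apply, smul_eq_mul, h, Finset.sum_add_distrib,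
    Finset.sum_ite_eq', Finset.mem_univ, if_true]
  ring

lemma lDelta_add_lUnit (n : ℕ) [NeZero n] (x : Fin n → ℝ) :
    lDelta n (x + lUnit n) = lDelta n x + 2 * x 0 + 1 := by
  simpa using lDelta_add_smul_lUnit n x 1

lemma lDelta_succ (m : ℕ) [NeZero (m + 1)] (x : Fin (m + 1) → ℝ) :
    lDelta (m + 1) x = x 0 ^ 2 - ∑ i : Fin m, x i.succ ^ 2 := by
  rw [lDelta, Fin.sum_univ_succ]
  ring

lemma lDelta_lt_lDelta_add {n : ℕ} [NeZero n] {x y : Fin n → ℝ} (hx : x ∈ lCone n)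
    (hy : y ∈ lCone n) : lDelta n x < lDelta n (x + y) := by
  obtain ⟨m, rfl⟩ := Nat.exists_eq_succ_of_ne_zero (NeZero.ne n)
  simp only [lCone, Set.mem_ofPred_eq, Nat.succ_eq_add_one, lDelta_succ] at *
  have hcs := Finset.sum_mul_sq_le_sq_mul_sq Finset.univ (fun i : Fin m => x i.succ)
    (fun i : Fin m => y i.succ)
  have h1 : ∑ i : Fin m, (x + y) i.succ ^ 2 = ∑ i : Fin m, x i.succ ^ 2
      + ∑ i : Fin m, y i.succ ^ 2 + 2 * ∑ i : Fin m, x i.succ * y i.succ := by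
    rw [Finset.mul_sum, ← Finset.sum_add_distrib, ← Finset.sum_add_distrib]
    refine Finset.sum_congr rfl fun i _ => ?_
    simp only [Pi.add_apply]
    ring
  have hxn : 0 ≤ ∑ i : Fin m, x i.succ ^ 2 := Finset.sum_nonneg fun i _ => sq_nonneg _
  have hyn : 0 ≤ ∑ i : Fin m, y i.succ ^ 2 := Finset.sum_nonneg fun i _ => sq_nonneg _
  rw [h1]
  set X := ∑ i : Fin m, x i.succ ^ 2
  set Y := ∑ i : Fin m, y i.succ ^ 2
  set Z := ∑ i : Fin m, x i.succ * y i.succ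
  have hZ : Z ≤ x 0 * y 0 := by
    refine (abs_le_of_sq_le_sq' ?_ (mul_pos hx.2 hy.2).le).2
    calc Z ^ 2 ≤ X * Y := hcs
      _ ≤ x 0 ^ 2 * y 0 ^ 2 := by gcongr <;> linarith
      _ = (x 0 * y 0) ^ 2 := by ring
  simp only [Pi.add_apply]
  nlinarith

lemma add_mem_lCone {n : ℕ} [NeZero n] {x y : Fin n → ℝ} (hx : x ∈ lCone n)
    (hy : y ∈ lCone n) : x + y ∈ lCone n :=
  ⟨hx.1.trans (lDelta_lt_lDelta_add hx hy), add_pos hx.2 hy.2⟩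

lemma smul_lUnit_mem_lCone (n : ℕ) [NeZero n] {c : ℝ} (hc : 0 < c) : c • lUnit n ∈ lCone n := by
  have h := lDelta_add_smul_lUnit n 0 c
  have h0 : lDelta n 0 = 0 := by simp [lDelta]
  refine ⟨?_, by simpa [lUnit] using hc⟩
  rw [zero_add, h0] at h
  simp only [h, Pi.zero_apply]
  positivity

lemma smul_mem_lCone {n : ℕ} [NeZero n] {x : Fin n → ℝ} (hx : x ∈ lCone n) {r : ℝ}
    (hr : 0 < r) : r • x ∈ lCone n := by
  refine ⟨?_, by simpa using mul_pos hr hx.2⟩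
  rw [lDelta_smul]
  exact mul_pos (by positivity) hx.1

/-- The order interval `(e/2, 2e)` of the Lorentz cone. -/
def lInterval (n : ℕ) [NeZero n] : Set (Fin n → ℝ) :=
  {x | x + (-(1 / 2) : ℝ) • lUnit n ∈ lCone n ∧ (2 : ℝ) • lUnit n - x ∈ lCone n}

@[fun_prop]
lemma continuous_lDelta (n : ℕ) [NeZero n] : Continuous (lDelta n) := by
  unfold lDelta
  fun_prop

@[fun_prop]
lemma measurable_lDelta (n : ℕ) [NeZero n] : Measurable (lDelta n) :=
  (continuous_lDelta n).measurable

lemma isOpen_lCone (n : ℕ) [NeZero n] : IsOpen (lCone n) :=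
  (isOpen_lt continuous_const (continuous_lDelta n)).inter
    (isOpen_lt continuous_const (continuous_apply 0))

lemma isOpen_lInterval (n : ℕ) [NeZero n] : IsOpen (lInterval n) :=
  ((isOpen_lCone n).preimage (by fun_prop)).inter ((isOpen_lCone n).preimage (by fun_prop))

lemma lUnit_mem_lInterval (n : ℕ) [NeZero n] : lUnit n ∈ lInterval n := by
  have h1 : lUnit n + (-(1 / 2) : ℝ) • lUnit n = (1 / 2 : ℝ) • lUnit n := by module
  have h2 : (2 : ℝ) • lUnit n - lUnit n = (1 : ℝ) • lUnit n := by module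
  exact ⟨h1 ▸ smul_lUnit_mem_lCone n (by norm_num), h2 ▸ smul_lUnit_mem_lCone n (by norm_num)⟩

lemma lInterval_subset_lCone (n : ℕ) [NeZero n] : lInterval n ⊆ lCone n := by
  intro x hx
  have h := add_mem_lCone hx.1 (smul_lUnit_mem_lCone n (show (0 : ℝ) < 1 / 2 by norm_num))
  have h2 : x + (-(1 / 2) : ℝ) • lUnit n + (1 / 2 : ℝ) • lUnit n = x := by module
  rwa [h2] at h

lemma lDelta_add_bounds {n : ℕ} [NeZero n] {x y : Fin n → ℝ} (hx : x ∈ lInterval n)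
    (hy : y ∈ lCone n) :
    lDelta n (y + lUnit n) / 4 ≤ lDelta n (y + x) ∧
      lDelta n (y + x) ≤ 4 * lDelta n (y + lUnit n) := by
  have hy1 := hy.1
  have hy2 := hy.2
  have h1 := lDelta_lt_lDelta_add
    (add_mem_lCone hy (smul_lUnit_mem_lCone n (show (0 : ℝ) < 1 / 2 by norm_num))) hx.1
  have h2 := lDelta_lt_lDelta_add (add_mem_lCone hy (lInterval_subset_lCone n hx)) hx.2
  have e1 : y + (1 / 2 : ℝ) • lUnit n + (x + (-(1 / 2) : ℝ) • lUnit n) = y + x := by module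
  have e2 : y + x + ((2 : ℝ) • lUnit n - x) = y + (2 : ℝ) • lUnit n := by module
  rw [e1, lDelta_add_smul_lUnit] at h1
  rw [e2, lDelta_add_smul_lUnit] at h2
  rw [lDelta_add_lUnit]
  constructor <;> linarith

lemma lDelta_bounds {n : ℕ} [NeZero n] {x : Fin n → ℝ} (hx : x ∈ lInterval n) :
    1 / 4 ≤ lDelta n x ∧ lDelta n x ≤ 4 := by
  have h0 : lDelta n 0 = 0 := by simp [lDelta]
  have h1 := lDelta_lt_lDelta_add
    (smul_lUnit_mem_lCone n (show (0 : ℝ) < 1 / 2 by norm_num)) hx.1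
  have h2 := lDelta_lt_lDelta_add (lInterval_subset_lCone n hx) hx.2
  have e1 : (1 / 2 : ℝ) • lUnit n + (x + (-(1 / 2) : ℝ) • lUnit n) = x := by module
  have e2 : x + ((2 : ℝ) • lUnit n - x) = 0 + (2 : ℝ) • lUnit n := by module
  rw [e1, ← zero_add ((1 / 2 : ℝ) • lUnit n), lDelta_add_smul_lUnit, h0] at h1
  rw [e2, lDelta_add_smul_lUnit, h0] at h2
  simp only [Pi.zero_apply] at h1 h2
  constructor <;> linarith

lemma lDelta_add_bounds_of_mem {n : ℕ} [NeZero n] {x y : Fin n → ℝ} (hx : x ∈ lInterval n)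
    (hy : y ∈ lInterval n) :
    1 / 16 ≤ lDelta n (y + x) ∧ lDelta n (y + x) ≤ 16 := by
  have h1 := lDelta_add_bounds hx (lInterval_subset_lCone n hy)
  have h2 := lDelta_lt_lDelta_add (lInterval_subset_lCone n hy) (lInterval_subset_lCone n hx)
  have h3 := lDelta_lt_lDelta_add (add_mem_lCone (lInterval_subset_lCone n hy)
    (lInterval_subset_lCone n hx)) (add_mem_lCone hy.2 hx.2)
  have e : y + x + ((2 : ℝ) • lUnit n - y + ((2 : ℝ) • lUnit n - x)) = 0 + (4 : ℝ) • lUnit n := by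
    module
  have h0 : lDelta n 0 = 0 := by simp [lDelta]
  rw [e, lDelta_add_smul_lUnit, h0] at h3
  have := (lDelta_bounds hy).1
  simp only [Pi.zero_apply] at h3
  constructor <;> linarith

lemma volume_lCone_inter_lt_top (n : ℕ) [NeZero n] (R : ℝ) :
    volume {x : Fin n → ℝ | x ∈ lCone n ∧ x 0 ≤ R} < ⊤ := by
  have hsub : {x : Fin n → ℝ | x ∈ lCone n ∧ x 0 ≤ R} ⊆
      Set.Icc (fun _ => -(2 * R)) fun _ => 2 * R := by
    rintro x ⟨⟨h1, h2⟩, h3⟩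
    have hi : ∀ i, |x i| ≤ 2 * R := by
      intro i
      have := Finset.single_le_sum (f := fun i => x i ^ 2) (fun i _ => sq_nonneg _)
        (Finset.mem_univ i)
      simp only [lDelta] at h1 this
      refine abs_le_of_sq_le_sq ?_ (by linarith)
      nlinarith
    exact ⟨fun i => (abs_le.1 (hi i)).1, fun i => (abs_le.1 (hi i)).2⟩
  exact (measure_mono hsub).trans_lt isCompact_Icc.measure_lt_top

lemma volume_lInterval_pos (n : ℕ) [NeZero n] : 0 < volume (lInterval n) :=
  (isOpen_lInterval n).measure_pos volume ⟨_, lUnit_mem_lInterval n⟩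

lemma volume_lInterval_lt_top (n : ℕ) [NeZero n] : volume (lInterval n) < ⊤ := by
  refine (measure_mono ?_).trans_lt (volume_lCone_inter_lt_top n 2)
  intro x hx
  refine ⟨lInterval_subset_lCone n hx, ?_⟩
  have := hx.2.2
  simp [lUnit] at this
  linarith

lemma rpow_bounds {t R : ℝ} (hR : 0 < R) (h1 : R / 16 ≤ t) (h2 : t ≤ 16 * R) (s : ℝ) :
    16 ^ (-|s|) * R ^ s ≤ t ^ s ∧ t ^ s ≤ 16 ^ |s| * R ^ s := by
  have ht : 0 < t := lt_of_lt_of_le (by positivity) h1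
  have h16 : (16 : ℝ) ^ (-|s|) = (1 / 16) ^ |s| := by
    rw [Real.rpow_neg (by norm_num), one_div, Real.inv_rpow (by norm_num)]
  rcases le_total 0 s with hs | hs
  · rw [h16, abs_of_nonneg hs, ← Real.mul_rpow (by norm_num) hR.le,
      ← Real.mul_rpow (by norm_num) hR.le]
    exact ⟨Real.rpow_le_rpow (by positivity) (by linarith) hs,
      Real.rpow_le_rpow ht.le h2 hs⟩
  · have h16' : (16 : ℝ) ^ (-s) = (1 / 16) ^ s := by
      rw [Real.rpow_neg (by norm_num), one_div, Real.inv_rpow (by norm_num)]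
    rw [abs_of_nonpos hs, neg_neg, h16', ← Real.mul_rpow (by norm_num) hR.le,
      ← Real.mul_rpow (by norm_num) hR.le]
    exact ⟨Real.rpow_le_rpow_of_nonpos ht h2 hs,
      Real.rpow_le_rpow_of_nonpos (by positivity) (by linarith) hs⟩

/-- The Lebesgue measure of the thin layer of the cone at height `Δ ≈ ε` is at least of
order `ε`. -/
lemma exists_volume_layer_ge (n : ℕ) [NeZero n] (hn : 2 ≤ n) :
    ∃ c : ℝ, 0 < c ∧ ∀ ε : ℝ, 0 < ε → ε ≤ 1 → ENNReal.ofReal (c * ε) ≤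
      volume {x : Fin n → ℝ | (1 ≤ x 0 ∧ x 0 ≤ 2) ∧ ε / 2 < lDelta n x ∧ lDelta n x ≤ ε} := by
  obtain ⟨m, rfl⟩ := Nat.exists_eq_succ_of_ne_zero (NeZero.ne n)
  have : NeZero m := ⟨by omega⟩
  set Z : Set (Fin m → ℝ) := {z | 1 < ∑ i, z i ^ 2 ∧ ∑ i, z i ^ 2 < 2} with hZ
  have hc : Continuous fun z : Fin m → ℝ => ∑ i, z i ^ 2 := by fun_prop
  have hZo : IsOpen Z := (isOpen_lt continuous_const hc).inter (isOpen_lt hc continuous_const)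
  have hZpos : 0 < volume Z := by
    refine hZo.measure_pos volume ⟨Pi.single 0 (6 / 5), ?_⟩
    have : ∑ i, (Pi.single 0 (6 / 5) : Fin m → ℝ) i ^ 2 = (6 / 5) ^ 2 := by
      rw [Finset.sum_eq_single 0] <;> simp +contextual
    simp only [hZ, Set.mem_ofPred_eq, this]
    norm_num
  obtain ⟨d, hd0, hd⟩ : ∃ d : ℝ, 0 < d ∧ ENNReal.ofReal d ≤ volume Z := by
    obtain ⟨d, hd0, hd⟩ := ENNReal.lt_iff_exists_nnreal_btwn.1 hZpos
    exact ⟨d, by exact_mod_cast hd0, by simpa using hd.le⟩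
  refine ⟨d / 8, by positivity, fun ε hε hε1 => ?_⟩
  set E : Set (Fin (m + 1) → ℝ) :=
    {x | (1 ≤ x 0 ∧ x 0 ≤ 2) ∧ ε / 2 < lDelta (m + 1) x ∧ lDelta (m + 1) x ≤ ε} with hE
  have hEm : MeasurableSet E := by
    have h1 : Measurable fun x : Fin (m + 1) → ℝ => x 0 := by fun_prop
    have h2 := measurable_lDelta (m + 1)
    exact ((measurableSet_le measurable_const h1).inter (measurableSet_le h1 measurable_const)).inter
      ((measurableSet_lt measurable_const h2).inter (measurableSet_le h2 measurable_const))
  have hmp := (volume_preserving_piFinSuccAbove (fun _ : Fin (m + 1) => ℝ) 0).symm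
  rw [← hmp.measure_preimage hEm.nullMeasurableSet, Measure.volume_eq_prod,
    Measure.prod_apply_symm (hmp.measurable hEm)]
  calc ENNReal.ofReal (d / 8 * ε) = ENNReal.ofReal (ε / 8) * ENNReal.ofReal d := by
        rw [← ENNReal.ofReal_mul (by positivity)]; congr 1; ring
    _ ≤ ENNReal.ofReal (ε / 8) * volume Z := by gcongr
    _ = ∫⁻ _ in Z, ENNReal.ofReal (ε / 8) := by rw [setLIntegral_const]
    _ ≤ ∫⁻ z in Z, volume ((fun t : ℝ => (t, z)) ⁻¹'
          ((MeasurableEquiv.piFinSuccAbove (fun _ : Fin (m + 1) => ℝ) 0).symm ⁻¹' E)) := by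
        refine setLIntegral_mono' hZo.measurableSet fun z hz => ?_
        set s := ∑ i, z i ^ 2
        obtain ⟨hs1, hs2⟩ : 1 < s ∧ s < 2 := hz
        have hsub : Set.Ioc (√(s + ε / 2)) (√(s + ε)) ⊆ (fun t : ℝ => (t, z)) ⁻¹'
          ((MeasurableEquiv.piFinSuccAbove (fun _ : Fin (m + 1) => ℝ) 0).symm ⁻¹' E) := by
          rintro t ⟨ht1, ht2⟩
          have ht0 : 0 < t := lt_of_le_of_lt (Real.sqrt_nonneg _) ht1
          have h1 : s + ε / 2 < t ^ 2 := (Real.sqrt_lt' ht0).1 ht1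
          have h2 : t ^ 2 ≤ s + ε := (Real.le_sqrt ht0.le (by linarith)).1 ht2
          simp only [Set.mem_preimage, MeasurableEquiv.piFinSuccAbove_symm_apply, hE,
            Set.mem_ofPred_eq, lDelta_succ, Fin.insertNthEquiv_zero, Fin.consEquiv_apply,
            Fin.cons_zero, Fin.cons_succ]
          refine ⟨⟨?_, ?_⟩, ?_, ?_⟩
          · nlinarith
          · nlinarith
          · change ε / 2 < t ^ 2 - s
            linarith
          · change t ^ 2 - s ≤ ε
            linarith
        refine le_trans ?_ (measure_mono hsub)
        rw [Real.volume_Ioc]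
        refine ENNReal.ofReal_le_ofReal ?_
        have ha := Real.sq_sqrt (show 0 ≤ s + ε / 2 by linarith)
        have hb := Real.sq_sqrt (show 0 ≤ s + ε by linarith)
        have ha2 : √(s + ε / 2) ≤ 2 := by
          rw [Real.sqrt_le_left (by norm_num)]; linarith
        have hb2 : √(s + ε) ≤ 2 := by
          rw [Real.sqrt_le_left (by norm_num)]; linarith
        have hab : √(s + ε / 2) ≤ √(s + ε) := Real.sqrt_le_sqrt (by linarith)
        nlinarith
    _ ≤ _ := setLIntegral_le_lintegral _ _

/-- The dilate by `R` of the layer `{1 ≤ x₀ ≤ 2, ε / 2 < Δ ≤ ε}`. -/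
def lLayer (n : ℕ) [NeZero n] (R ε : ℝ) : Set (Fin n → ℝ) :=
  {x | (R ≤ x 0 ∧ x 0 ≤ 2 * R) ∧ R ^ 2 * (ε / 2) < lDelta n x ∧ lDelta n x ≤ R ^ 2 * ε}

lemma measurableSet_lLayer (n : ℕ) [NeZero n] (R ε : ℝ) : MeasurableSet (lLayer n R ε) := by
  have h1 : Measurable fun x : Fin n → ℝ => x 0 := by fun_prop
  have h2 := measurable_lDelta n
  exact ((measurableSet_le measurable_const h1).inter (measurableSet_le h1 measurable_const)).inter
    ((measurableSet_lt measurable_const h2).inter (measurableSet_le h2 measurable_const))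

lemma exists_volume_lLayer_ge (n : ℕ) [NeZero n] (hn : 2 ≤ n) :
    ∃ c : ℝ, 0 < c ∧ ∀ R ε : ℝ, 0 < R → 0 < ε → ε ≤ 1 →
      ENNReal.ofReal (c * ε * R ^ n) ≤ volume (lLayer n R ε) := by
  obtain ⟨c, hc, h⟩ := exists_volume_layer_ge n hn
  refine ⟨c, hc, fun R ε hR hε hε1 => ?_⟩
  calc ENNReal.ofReal (c * ε * R ^ n)
      = ENNReal.ofReal |R ^ Module.finrank ℝ (Fin n → ℝ)| * ENNReal.ofReal (c * ε) := by
        rw [Module.finrank_fin_fun, abs_of_pos (by positivity),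
          ← ENNReal.ofReal_mul (by positivity)]
        congr 1
        ring
    _ ≤ _ := mul_le_mul_right (h ε hε hε1) _
    _ = _ := (Measure.addHaar_smul volume R _).symm
    _ ≤ _ := by
        refine measure_mono ?_
        rintro _ ⟨x, ⟨⟨h1, h2⟩, h3, h4⟩, rfl⟩
        simp only [lLayer, Set.mem_ofPred_eq, lDelta_smul, Pi.smul_apply, smul_eq_mul]
        refine ⟨⟨by nlinarith, by nlinarith⟩, by gcongr, by gcongr⟩

lemma setLIntegral_eq_top_of_disjoint {X : Type*} [MeasurableSpace X] {μ : Measure X} {s : Set X}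
    {f : X → ℝ} {E : ℕ → Set X} (hE : ∀ k, MeasurableSet (E k))
    (hd : Pairwise (Function.onFun Disjoint E)) (hs : ∀ k, E k ⊆ s) {δ : ℕ → ℝ}
    (hf : ∀ k, ∀ x ∈ E k, δ k ≤ f x) {c : ℝ} (hc : 0 < c)
    (hv : ∀ k, ENNReal.ofReal c ≤ ENNReal.ofReal (δ k) * μ (E k)) :
    ∫⁻ x in s, ENNReal.ofReal (f x) ∂μ = ⊤ := by
  rw [eq_top_iff]
  calc (⊤ : ℝ≥0∞) = ∑' _ : ℕ, ENNReal.ofReal c :=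
        (ENNReal.tsum_const_eq_top_of_ne_zero (by simpa using hc)).symm
    _ ≤ ∑' k, ∫⁻ x in E k, ENNReal.ofReal (f x) ∂μ := by
        refine ENNReal.tsum_le_tsum fun k => (hv k).trans ?_
        rw [← setLIntegral_const]
        exact setLIntegral_mono' (hE k) fun x hx => ENNReal.ofReal_le_ofReal (hf k x hx)
    _ = ∫⁻ x in ⋃ k, E k, ENNReal.ofReal (f x) ∂μ := (lintegral_iUnion hE hd _).symm
    _ ≤ _ := lintegral_mono_set (Set.iUnion_subset hs)

lemma lLayer_subset_lCone (n : ℕ) [NeZero n] {R ε : ℝ} (hR : 0 < R) (hε : 0 < ε) :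
    lLayer n R ε ⊆ lCone n := fun _ hx =>
  ⟨lt_trans (by positivity) hx.2.1, lt_of_lt_of_le hR hx.1.1⟩

lemma neg_one_lt_of_lintegral_lt_top (n : ℕ) [NeZero n] (hn : 2 ≤ n) {a b : ℝ}
    (h : ∫⁻ x in lCone n, ENNReal.ofReal (lDelta n x ^ a * lDelta n (x + lUnit n) ^ (-b)) < ⊤) :
    -1 < a := by
  by_contra! ha
  obtain ⟨c, hc, hv⟩ := exists_volume_lLayer_ge n hn
  have hpos : ∀ k : ℕ, (0 : ℝ) < (1 / 2) ^ k := fun k => by positivity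
  have hle : ∀ k : ℕ, ((1 : ℝ) / 2) ^ k ≤ 1 := fun k => pow_le_one₀ (by norm_num) (by norm_num)
  refine h.ne (setLIntegral_eq_top_of_disjoint (E := fun k => lLayer n 1 ((1 / 2) ^ k))
    (δ := fun k => ((1 / 2 : ℝ) ^ k) ^ a * 16 ^ (-|-b|)) (c := c * 16 ^ (-|-b|))
    (fun k => measurableSet_lLayer _ _ _) ?_
    (fun k => lLayer_subset_lCone n one_pos (hpos k)) ?_ (by positivity) ?_)
  · refine (pairwise_disjoint_on _).2 fun i j hij => Set.disjoint_left.2 fun x hx hy => ?_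
    have h1 : ((1 : ℝ) / 2) ^ j ≤ (1 / 2) ^ (i + 1) :=
      pow_le_pow_of_le_one (by norm_num) (by norm_num) hij
    have h2 := hx.2.1
    have h3 := hy.2.2
    rw [pow_succ] at h1
    linarith
  · intro k x hx
    have h0 := (lLayer_subset_lCone n one_pos (hpos k) hx).1
    have h2 : lDelta n x ≤ (1 / 2) ^ k := by simpa using hx.2.2
    have h3 := hx.1
    have h4 := hle k
    refine mul_le_mul (Real.rpow_le_rpow_of_nonpos h0 h2 (by linarith)) ?_ (by positivity)
      (by positivity)
    refine le_trans (by simp) (rpow_bounds (R := 1) one_pos ?_ ?_ (-b)).1 <;>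
    · rw [lDelta_add_lUnit]
      linarith
  · intro k
    refine le_trans ?_ (mul_le_mul_right (hv 1 _ one_pos (hpos k) (hle k)) _)
    rw [← ENNReal.ofReal_mul (by positivity)]
    refine ENNReal.ofReal_le_ofReal ?_
    have h1 : 1 ≤ ((1 / 2 : ℝ) ^ k) ^ a * (1 / 2) ^ k := by
      nth_rewrite 2 [← Real.rpow_one ((1 / 2 : ℝ) ^ k)]
      rw [← Real.rpow_add (hpos k)]
      exact Real.one_le_rpow_of_pos_of_le_one_of_nonpos (hpos k) (hle k) (by linarith)
    calc c * 16 ^ (-|-b|) = c * 16 ^ (-|-b|) * 1 := by ring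
      _ ≤ c * 16 ^ (-|-b|) * (((1 / 2 : ℝ) ^ k) ^ a * (1 / 2) ^ k) := by gcongr
      _ = _ := by ring

lemma lt_sub_of_lintegral_lt_top (n : ℕ) [NeZero n] (hn : 2 ≤ n) {a b : ℝ}
    (h : ∫⁻ x in lCone n, ENNReal.ofReal (lDelta n x ^ a * lDelta n (x + lUnit n) ^ (-b)) < ⊤) :
    (n : ℝ) - 1 < b - a := by
  by_contra! hab
  obtain ⟨c, hc, hv⟩ := exists_volume_lLayer_ge n hn
  have hpos : ∀ k : ℕ, (0 : ℝ) < 4 ^ k := fun k => by positivity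
  have hone : ∀ k : ℕ, (1 : ℝ) ≤ 4 ^ k := fun k => one_le_pow₀ (by norm_num)
  have hε : ∀ k : ℕ, (0 : ℝ) < (4 ^ k)⁻¹ := fun k => by positivity
  have hL : ∀ k : ℕ, ∀ x ∈ lLayer n (4 ^ k) (4 ^ k)⁻¹,
      (4 : ℝ) ^ k / 2 < lDelta n x ∧ lDelta n x ≤ 4 ^ k := by
    intro k x hx
    have e1 : ((4 : ℝ) ^ k) ^ 2 * ((4 ^ k)⁻¹ / 2) = 4 ^ k / 2 := by
      field_simp
    have e2 : ((4 : ℝ) ^ k) ^ 2 * (4 ^ k)⁻¹ = 4 ^ k := by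
      field_simp
    exact ⟨e1 ▸ hx.2.1, e2 ▸ hx.2.2⟩
  refine h.ne (setLIntegral_eq_top_of_disjoint (E := fun k => lLayer n (4 ^ k) (4 ^ k)⁻¹)
    (δ := fun k => (16 ^ (-|a|) * ((4 : ℝ) ^ k) ^ a) * (16 ^ (-|-b|) * ((4 : ℝ) ^ k) ^ (-b)))
    (c := c * 16 ^ (-|a|) * 16 ^ (-|-b|))
    (fun k => measurableSet_lLayer _ _ _) ?_
    (fun k => lLayer_subset_lCone n (hpos k) (hε k)) ?_ (by positivity) ?_)
  · refine (pairwise_disjoint_on _).2 fun i j hij => Set.disjoint_left.2 fun x hx hy => ?_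
    have h1 : (4 : ℝ) ^ (i + 1) ≤ 4 ^ j := pow_le_pow_right₀ (by norm_num) hij
    have h2 := hx.1.2
    have h3 := hy.1.1
    have := hpos i
    rw [pow_succ] at h1
    linarith
  · intro k x hx
    obtain ⟨h1, h2⟩ := hL k x hx
    have h3 := hx.1
    have h4 := hone k
    have h0 := (lLayer_subset_lCone n (hpos k) (hε k) hx).1
    refine mul_le_mul (rpow_bounds (hpos k) (by linarith) (by linarith) a).1
      (rpow_bounds (hpos k) ?_ ?_ (-b)).1 (by positivity) (by positivity) <;>
    · rw [lDelta_add_lUnit]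
      linarith
  · intro k
    refine le_trans ?_ (mul_le_mul_right
      (hv (4 ^ k) _ (hpos k) (hε k) (inv_le_one_of_one_le₀ (hone k))) _)
    rw [← ENNReal.ofReal_mul (by positivity)]
    refine ENNReal.ofReal_le_ofReal ?_
    have h1 : 1 ≤ ((4 : ℝ) ^ k) ^ a * ((4 : ℝ) ^ k) ^ (-b) * ((4 ^ k)⁻¹ * (4 ^ k) ^ n) := by
      have e : ((4 : ℝ) ^ k)⁻¹ * (4 ^ k) ^ n = ((4 : ℝ) ^ k) ^ ((n : ℝ) - 1) := by
        rw [Real.rpow_sub (hpos k), Real.rpow_natCast, Real.rpow_one]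
        ring
      rw [e, ← Real.rpow_add (hpos k), ← Real.rpow_add (hpos k)]
      exact Real.one_le_rpow (hone k) (by linarith)
    calc c * 16 ^ (-|a|) * 16 ^ (-|-b|) = c * 16 ^ (-|a|) * 16 ^ (-|-b|) * 1 := by ring
      _ ≤ c * 16 ^ (-|a|) * 16 ^ (-|-b|) *
          (((4 : ℝ) ^ k) ^ a * ((4 : ℝ) ^ k) ^ (-b) * ((4 ^ k)⁻¹ * (4 ^ k) ^ n)) := by gcongr
      _ = _ := by ring

/-- Converse of Hölder's inequality on the cone, for positive weights. -/
lemma lintegral_lt_top_of_forall_le (n : ℕ) [NeZero n] {p : ℝ} (hp : 1 < p)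
    {w ρ : (Fin n → ℝ) → ℝ} (hw : Measurable w) (hρ : Measurable ρ)
    (hw0 : ∀ x ∈ lCone n, 0 < w x) (hρ0 : ∀ x ∈ lCone n, 0 < ρ x) {C : ℝ≥0∞} (hC : C < ⊤)
    (H : ∀ g : (Fin n → ℝ) → ℝ, Measurable g →
      ∫⁻ x in lCone n, ENNReal.ofReal (|g x| ^ p * ρ x) < ⊤ →
      ∫⁻ x in lCone n, ENNReal.ofReal (w x * |g x|) ≤
        C * (∫⁻ x in lCone n, ENNReal.ofReal (|g x| ^ p * ρ x)) ^ (1 / p)) :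
    ∫⁻ x in lCone n, ENNReal.ofReal (w x * (w x / ρ x) ^ (1 / (p - 1))) < ⊤ := by
  have hp0 : 0 < p - 1 := by linarith
  set G : (Fin n → ℝ) → ℝ := fun x => w x * (w x / ρ x) ^ (1 / (p - 1)) with hG
  have hGm : Measurable G := by fun_prop
  set K : ℕ → Set (Fin n → ℝ) := fun m => {x | x ∈ lCone n ∧ x 0 ≤ m} ∩ {x | G x ≤ m} with hK
  have hx0 : Measurable fun x : Fin n → ℝ => x 0 := by fun_prop
  have hKm : ∀ m, MeasurableSet (K m) := fun m =>
    ((isOpen_lCone n).measurableSet.inter (measurableSet_le hx0 measurable_const)).inter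
      (measurableSet_le hGm measurable_const)
  have hKmono : Monotone K := by
    intro i j hij x hx
    have : (i : ℝ) ≤ j := by exact_mod_cast hij
    exact ⟨⟨hx.1.1, hx.1.2.trans this⟩, le_trans hx.2 this⟩
  have hKU : lCone n = ⋃ m, K m := by
    refine Set.Subset.antisymm (fun x hx => ?_) (Set.iUnion_subset fun m x hx => hx.1.1)
    obtain ⟨m, hm⟩ := exists_nat_ge (max (x 0) (G x))
    exact Set.mem_iUnion.2 ⟨m, ⟨hx, (le_max_left _ _).trans hm⟩, (le_max_right _ _).trans hm⟩
  have hbound : ∀ m, ∫⁻ x in K m, ENNReal.ofReal (G x) ≤ C ^ (1 / (1 - 1 / p)) := by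
    intro m
    set I := ∫⁻ x in K m, ENNReal.ofReal (G x) with hI
    have hIfin : I < ⊤ := by
      calc I ≤ ∫⁻ _ in K m, ENNReal.ofReal m :=
            setLIntegral_mono' (hKm m) fun x hx => ENNReal.ofReal_le_ofReal hx.2
        _ = ENNReal.ofReal m * volume (K m) := setLIntegral_const _ _
        _ < ⊤ := ENNReal.mul_lt_top ENNReal.ofReal_lt_top
            ((measure_mono Set.inter_subset_left).trans_lt (volume_lCone_inter_lt_top n m))
    set g : (Fin n → ℝ) → ℝ := (K m).indicator fun x => (w x / ρ x) ^ (1 / (p - 1)) with hg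
    have hgm : Measurable g := Measurable.indicator (by fun_prop) (hKm m)
    have hKsub : K m ⊆ lCone n := fun x hx => hx.1.1
    have key : ∀ f : (Fin n → ℝ) → ℝ, (∀ x ∈ K m, f x = G x) → (∀ x ∉ K m, f x = 0) →
        ∫⁻ x in lCone n, ENNReal.ofReal (f x) = I := by
      intro f h1 h2
      have : (fun x => ENNReal.ofReal (f x)) = (K m).indicator fun x => ENNReal.ofReal (G x) := by
        funext x
        by_cases hx : x ∈ K m
        · simp [hx, h1]
        · simp [hx, h2]
      rw [this, setLIntegral_indicator (hKm m), Set.inter_eq_left.2 hKsub]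
    have e1 : ∫⁻ x in lCone n, ENNReal.ofReal (w x * |g x|) = I := by
      refine key _ (fun x hx => ?_) fun x hx => by simp [hg, hx]
      have := hw0 x (hKsub hx)
      have := hρ0 x (hKsub hx)
      rw [hg, Set.indicator_of_mem hx, abs_of_pos (by positivity)]
    have e2 : ∫⁻ x in lCone n, ENNReal.ofReal (|g x| ^ p * ρ x) = I := by
      refine key _ (fun x hx => ?_) fun x hx => by simp [hg, hx, show p ≠ 0 by linarith]
      have h1 := hw0 x (hKsub hx)
      have h2 := hρ0 x (hKsub hx)
      have h3 : 0 < w x / ρ x := by positivity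
      rw [hg, Set.indicator_of_mem hx, abs_of_pos (by positivity), ← Real.rpow_mul h3.le,
        show 1 / (p - 1) * p = 1 + 1 / (p - 1) by field_simp; ring, Real.rpow_add h3,
        Real.rpow_one, hG]
      field_simp
    have hle := H g hgm (e2 ▸ hIfin)
    rw [e1, e2] at hle
    rcases eq_or_ne I 0 with h0 | h0
    · simp [h0]
    have hq : 0 < 1 - 1 / p := by
      rw [sub_pos, div_lt_one (by linarith)]; exact hp
    rw [one_div (1 - 1 / p), ENNReal.le_rpow_inv_iff hq]
    have hJ0 : I ^ (1 / p) ≠ 0 := by simp [ENNReal.rpow_eq_zero_iff, h0, hIfin.ne]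
    have hJt : I ^ (1 / p) ≠ ⊤ := ENNReal.rpow_ne_top_of_nonneg (by positivity) hIfin.ne
    rw [ENNReal.rpow_sub _ _ h0 hIfin.ne, ENNReal.rpow_one]
    exact ENNReal.div_le_of_le_mul hle
  rw [hKU, setLIntegral_iUnion_of_directed _ hKmono.directed_le]
  exact (iSup_le hbound).trans_lt (ENNReal.rpow_lt_top_of_nonneg (by
    have : 1 / p ≤ 1 := by rw [div_le_one (by linarith)]; exact hp.le
    exact div_nonneg zero_le_one (by linarith)) hC.ne)

/-- The dilate of the order interval `(e/2, 2e)` on which `Δ` is comparable to `t`. -/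
def lDilate (n : ℕ) [NeZero n] (t : ℝ) : Set (Fin n → ℝ) := {x | (√t)⁻¹ • x ∈ lInterval n}

lemma measurableSet_lDilate (n : ℕ) [NeZero n] (t : ℝ) : MeasurableSet (lDilate n t) :=
  ((isOpen_lInterval n).preimage (by fun_prop)).measurableSet

lemma lDilate_one (n : ℕ) [NeZero n] : lDilate n 1 = lInterval n := by
  ext x
  simp [lDilate]

lemma lDelta_eq_mul {n : ℕ} [NeZero n] {t : ℝ} (ht : 0 < t) (x : Fin n → ℝ) :
    lDelta n x = t * lDelta n ((√t)⁻¹ • x) := by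
  rw [lDelta_smul, inv_pow, Real.sq_sqrt ht.le]
  field_simp

lemma lDilate_subset_lCone (n : ℕ) [NeZero n] {t : ℝ} (ht : 0 < t) :
    lDilate n t ⊆ lCone n := by
  intro x hx
  have hs : 0 < √t := Real.sqrt_pos.2 ht
  have h := smul_mem_lCone (lInterval_subset_lCone n hx) hs
  rwa [smul_inv_smul₀ hs.ne'] at h

lemma lDelta_bounds_of_mem_lDilate {n : ℕ} [NeZero n] {t : ℝ} (ht : 0 < t) {x : Fin n → ℝ}
    (hx : x ∈ lDilate n t) : t / 16 ≤ lDelta n x ∧ lDelta n x ≤ 16 * t := by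
  obtain ⟨h1, h2⟩ := lDelta_bounds hx
  rw [lDelta_eq_mul ht]
  constructor <;> nlinarith

lemma lDelta_add_bounds_of_mem_lDilate {n : ℕ} [NeZero n] {t : ℝ} (ht : 0 < t)
    {x y : Fin n → ℝ} (hx : x ∈ lDilate n t) (hy : y ∈ lDilate n t) :
    t / 16 ≤ lDelta n (y + x) ∧ lDelta n (y + x) ≤ 16 * t := by
  obtain ⟨h1, h2⟩ := lDelta_add_bounds_of_mem hx hy
  rw [← smul_add] at h1 h2
  rw [lDelta_eq_mul ht]
  constructor <;> nlinarith

open scoped Pointwise in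
lemma exists_volume_lDilate_eq (n : ℕ) [NeZero n] :
    ∃ v : ℝ, 0 < v ∧ ∀ t : ℝ, 0 < t →
      volume (lDilate n t) = ENNReal.ofReal (v * t ^ ((n : ℝ) / 2)) := by
  have hfin := (volume_lInterval_lt_top n).ne
  refine ⟨(volume (lInterval n)).toReal,
    ENNReal.toReal_pos (volume_lInterval_pos n).ne' hfin, fun t ht => ?_⟩
  have hs : 0 < √t := Real.sqrt_pos.2 ht
  have e : lDilate n t = √t • lInterval n := by
    ext x
    exact (Set.mem_smul_set_iff_inv_smul_mem₀ hs.ne' _ _).symm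
  rw [e, Measure.addHaar_smul, Module.finrank_fin_fun, abs_of_pos (by positivity),
    ENNReal.ofReal_mul ENNReal.toReal_nonneg, ENNReal.ofReal_toReal hfin, mul_comm]
  congr 2
  rw [Real.sqrt_eq_rpow, ← Real.rpow_natCast, ← Real.rpow_mul ht.le]
  congr 1
  ring

lemma mul_rpow_le_SopNorm {n : ℕ} [NeZero n] {α β γ q μ : ℝ} (hq : 0 < q)
    {g : (Fin n → ℝ) → ℝ} {A : Set (Fin n → ℝ)} (hA : MeasurableSet A) (hAs : A ⊆ lCone n)
    {M : ℝ≥0∞} (hM : ∀ y ∈ A, M ≤ Sop n α β γ g y) {d : ℝ}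
    (hd : ∀ y ∈ A, d ≤ lDelta n y ^ (μ - (n : ℝ) / 2)) :
    M * (ENNReal.ofReal d * volume A) ^ (1 / q) ≤ SopNorm n α β γ q μ g := by
  have e : M = (M ^ q) ^ (1 / q) := by
    rw [← ENNReal.rpow_mul, mul_one_div_cancel hq.ne', ENNReal.rpow_one]
  rw [e, ← ENNReal.mul_rpow_of_nonneg _ _ (by positivity), SopNorm, ← mul_assoc,
    ← setLIntegral_const]
  refine ENNReal.rpow_le_rpow ?_ (by positivity)
  refine le_trans (setLIntegral_mono' hA fun y hy => ?_) (lintegral_mono_set hAs)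
  have := hM y hy
  have := hd y hy
  gcongr

lemma coneNorm_indicator_lDilate_le (n : ℕ) [NeZero n] {p : ℝ} (hp : 0 < p) (ν : ℝ) {v t : ℝ}
    (hv : 0 < v) (ht : 0 < t)
    (hvol : volume (lDilate n t) = ENNReal.ofReal (v * t ^ ((n : ℝ) / 2))) :
    coneNorm n p ν ((lDilate n t).indicator 1) ≤
      ENNReal.ofReal ((16 ^ |ν - (n : ℝ) / 2| * v) ^ (1 / p) * t ^ (ν / p)) := by
  have hmeas := measurableSet_lDilate n t
  have e1 : (fun y => ENNReal.ofReal (|(lDilate n t).indicator (1 : (Fin n → ℝ) → ℝ) y| ^ p *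
      lDelta n y ^ (ν - (n : ℝ) / 2))) = (lDilate n t).indicator
        fun y => ENNReal.ofReal (lDelta n y ^ (ν - (n : ℝ) / 2)) := by
    funext y
    by_cases hy : y ∈ lDilate n t
    · simp [hy]
    · simp [hy, hp.ne']
  rw [coneNorm, e1, setLIntegral_indicator hmeas,
    Set.inter_eq_left.2 (lDilate_subset_lCone n ht)]
  have e2 : (16 ^ |ν - (n : ℝ) / 2| * v) ^ (1 / p) * t ^ (ν / p) =
      (16 ^ |ν - (n : ℝ) / 2| * t ^ (ν - (n : ℝ) / 2) * (v * t ^ ((n : ℝ) / 2))) ^ (1 / p) := by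
    have : t ^ ν = t ^ (ν - (n : ℝ) / 2) * t ^ ((n : ℝ) / 2) := by
      rw [← Real.rpow_add ht]; congr 1; ring
    rw [← mul_one_div ν p, Real.rpow_mul ht.le, ← Real.mul_rpow (by positivity) (by positivity),
      this]
    congr 1
    ring
  rw [e2, ← ENNReal.ofReal_rpow_of_pos (by positivity), ENNReal.ofReal_mul (by positivity),
    ← hvol, ← setLIntegral_const]
  refine ENNReal.rpow_le_rpow (setLIntegral_mono' hmeas fun y hy => ?_) (by positivity)
  obtain ⟨h1, h2⟩ := lDelta_bounds_of_mem_lDilate ht hy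
  exact ENNReal.ofReal_le_ofReal (rpow_bounds ht h1 h2 _).2

lemma measurable_indicator_lDilate (n : ℕ) [NeZero n] (t : ℝ) :
    Measurable ((lDilate n t).indicator (1 : (Fin n → ℝ) → ℝ)) :=
  measurable_one.indicator (measurableSet_lDilate n t)

lemma Sop_indicator_ge {n : ℕ} [NeZero n] {α β γ k : ℝ} {A : Set (Fin n → ℝ)}
    (hA : MeasurableSet A) (hAs : A ⊆ lCone n) (y : Fin n → ℝ)
    (hk : ∀ x ∈ A, k ≤ lDelta n (y + x) ^ (-γ) * lDelta n x ^ β) :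
    ENNReal.ofReal (lDelta n y ^ α) * (ENNReal.ofReal k * volume A) ≤
      Sop n α β γ (A.indicator 1) y := by
  rw [Sop, ← setLIntegral_const]
  refine mul_le_mul_right (le_trans (setLIntegral_mono' hA fun x hx => ?_)
    (lintegral_mono_set hAs)) _
  refine ENNReal.ofReal_le_ofReal ?_
  simpa [hx] using hk x hx

lemma eq_of_forall_mul_rpow_le {a b c d : ℝ} (hc : 0 < c)
    (h : ∀ t : ℝ, 0 < t → c * t ^ a ≤ d * t ^ b) : a = b := by
  have h' : ∀ t : ℝ, 0 < t → t ^ (a - b) ≤ d / c := by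
    intro t ht
    rw [Real.rpow_sub ht, div_le_div_iff₀ (by positivity) hc]
    linarith [h t ht]
  have key : ∀ s : ℝ, 0 < s → (∀ t : ℝ, 0 < t → t ^ s ≤ d / c) → False := by
    intro s hs hb
    have hD : 0 < d / c := (Real.rpow_pos_of_pos one_pos s).trans_le (hb 1 one_pos)
    have h1 := hb ((d / c + 1) ^ s⁻¹) (by positivity)
    rw [← Real.rpow_mul (by positivity), inv_mul_cancel₀ hs.ne', Real.rpow_one] at h1
    linarith
  rcases lt_trichotomy (a - b) 0 with hs | hs | hs
  · refine (key (-(a - b)) (by linarith) fun t ht => ?_).elim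
    have := h' t⁻¹ (by positivity)
    rwa [Real.inv_rpow ht.le, ← Real.rpow_neg ht.le] at this
  · linarith
  · exact (key _ hs h').elim

lemma SBounded.homogeneity {n : ℕ} [NeZero n] {α β γ p ν q μ : ℝ} (hp : 0 < p) (hq : 0 < q)
    (hS : SBounded n α β γ p ν q μ) : γ = α + β + (n : ℝ) / 2 - ν / p + μ / q := by
  obtain ⟨C, hC, hb⟩ := hS
  obtain ⟨v, hv, hvol⟩ := exists_volume_lDilate_eq n
  have key : α + (-γ + β) + (n : ℝ) / 2 + μ / q = ν / p := by
    refine eq_of_forall_mul_rpow_le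
      (c := 16 ^ (-|α|) * 16 ^ (-|-γ|) * 16 ^ (-|β|) * v *
        (16 ^ (-|μ - (n : ℝ) / 2|) * v) ^ (1 / q))
      (d := C * (16 ^ |ν - (n : ℝ) / 2| * v) ^ (1 / p)) (by positivity) fun t ht => ?_
    have hmeas := measurableSet_lDilate n t
    have hsub := lDilate_subset_lCone n ht
    have hn := coneNorm_indicator_lDilate_le n hp ν hv ht (hvol t ht)
    have h1 := hb _ (measurable_indicator_lDilate n t) (hn.trans_lt ENNReal.ofReal_lt_top)
    have h2 := h1.trans (mul_le_mul_right hn _)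
    have h3 := (mul_rpow_le_SopNorm (α := α) (β := β) (γ := γ) (μ := μ) hq hmeas hsub
      (g := (lDilate n t).indicator 1)
      (M := ENNReal.ofReal (16 ^ (-|α|) * t ^ α) * (ENNReal.ofReal
        ((16 ^ (-|-γ|) * t ^ (-γ)) * (16 ^ (-|β|) * t ^ β)) * volume (lDilate n t)))
      (fun y hy => ?_)
      (d := 16 ^ (-|μ - (n : ℝ) / 2|) * t ^ (μ - (n : ℝ) / 2)) fun y hy => ?_).trans h2
    · rw [hvol t ht, ← ENNReal.ofReal_mul (by positivity), ← ENNReal.ofReal_mul (by positivity),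
        ← ENNReal.ofReal_mul (by positivity), ENNReal.ofReal_rpow_of_pos (by positivity),
        ← ENNReal.ofReal_mul (by positivity), ← ENNReal.ofReal_mul hC.le,
        ENNReal.ofReal_le_ofReal_iff (by positivity)] at h3
      have e : 16 ^ (-|μ - (n : ℝ) / 2|) * t ^ (μ - (n : ℝ) / 2) * (v * t ^ ((n : ℝ) / 2)) =
          16 ^ (-|μ - (n : ℝ) / 2|) * v * t ^ μ := by
        have : t ^ μ = t ^ (μ - (n : ℝ) / 2) * t ^ ((n : ℝ) / 2) := by
          rw [← Real.rpow_add ht]; congr 1; ring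
        rw [this]; ring
      rw [e, Real.mul_rpow (by positivity) (by positivity), ← Real.rpow_mul ht.le,
        mul_one_div] at h3
      rw [Real.rpow_add ht, Real.rpow_add ht, Real.rpow_add ht, Real.rpow_add ht]
      refine le_trans (le_of_eq ?_) (h3.trans (le_of_eq ?_)) <;> ring
    · refine le_trans ?_ (Sop_indicator_ge
        (k := (16 ^ (-|-γ|) * t ^ (-γ)) * (16 ^ (-|β|) * t ^ β)) hmeas hsub y fun x hx => ?_)
      · obtain ⟨b1, b2⟩ := lDelta_bounds_of_mem_lDilate ht hy
        exact mul_le_mul_left (ENNReal.ofReal_le_ofReal (rpow_bounds ht b1 b2 α).1) _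
      · obtain ⟨b1, b2⟩ := lDelta_bounds_of_mem_lDilate ht hx
        obtain ⟨b3, b4⟩ := lDelta_add_bounds_of_mem_lDilate ht hx hy
        have := (hsub hx).1
        exact mul_le_mul (rpow_bounds ht b3 b4 _).1 (rpow_bounds ht b1 b2 _).1 (by positivity)
          (Real.rpow_nonneg (le_trans (by positivity) b3) _)
    · obtain ⟨b1, b2⟩ := lDelta_bounds_of_mem_lDilate ht hy
      exact (rpow_bounds ht b1 b2 _).1
  linarith

lemma lDelta_add_rpow_ge {n : ℕ} [NeZero n] {x y : Fin n → ℝ} (hx : x ∈ lInterval n)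
    (hy : y ∈ lCone n) (s : ℝ) :
    16 ^ (-|s|) * lDelta n (y + lUnit n) ^ s ≤ lDelta n (y + x) ^ s := by
  have h0 := (add_mem_lCone hy (lInterval_subset_lCone n (lUnit_mem_lInterval n))).1
  obtain ⟨b1, b2⟩ := lDelta_add_bounds hx hy
  exact (rpow_bounds h0 (by linarith) (by linarith) s).1

lemma lDelta_add_lUnit_pos {n : ℕ} [NeZero n] {x : Fin n → ℝ} (hx : x ∈ lCone n) :
    0 < lDelta n (x + lUnit n) :=
  (add_mem_lCone hx (lInterval_subset_lCone n (lUnit_mem_lInterval n))).1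

lemma SBounded.lintegral_target_lt_top {n : ℕ} [NeZero n] {α β γ p ν q μ : ℝ} (hp : 0 < p)
    (hq : 0 < q) (hS : SBounded n α β γ p ν q μ) :
    ∫⁻ y in lCone n, ENNReal.ofReal (lDelta n y ^ (q * α + μ - (n : ℝ) / 2) *
      lDelta n (y + lUnit n) ^ (-(q * γ))) < ⊤ := by
  obtain ⟨C, hC, hb⟩ := hS
  obtain ⟨v, hv, hvol⟩ := exists_volume_lDilate_eq n
  have hn := (coneNorm_indicator_lDilate_le n hp ν hv one_pos (hvol 1 one_pos)).trans_lt
    ENNReal.ofReal_lt_top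
  have hlt := (hb _ (measurable_indicator_lDilate n 1) hn).trans_lt
    (ENNReal.mul_lt_top ENNReal.ofReal_lt_top hn)
  rw [SopNorm, ENNReal.rpow_lt_top_iff_of_pos (by positivity)] at hlt
  have hv1 := hvol 1 one_pos
  rw [lDilate_one] at hlt hv1
  rw [Real.one_rpow, mul_one] at hv1
  set k : ℝ := 16 ^ (-|-γ|) * 16 ^ (-|β|) * v with hk
  have hkpos : 0 < k := by positivity
  have hle : ENNReal.ofReal (k ^ q) * ∫⁻ y in lCone n, ENNReal.ofReal
      (lDelta n y ^ (q * α + μ - (n : ℝ) / 2) * lDelta n (y + lUnit n) ^ (-(q * γ))) < ⊤ := by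
    rw [← lintegral_const_mul' _ _ ENNReal.ofReal_ne_top]
    refine lt_of_le_of_lt (setLIntegral_mono' (isOpen_lCone n).measurableSet fun y hy => ?_) hlt
    have h0 := hy.1
    have h1 := lDelta_add_lUnit_pos hy
    have hSop : ENNReal.ofReal (lDelta n y ^ α * (k * lDelta n (y + lUnit n) ^ (-γ))) ≤
        Sop n α β γ ((lInterval n).indicator 1) y := by
      refine le_trans (le_of_eq ?_) (Sop_indicator_ge
        (k := 16 ^ (-|-γ|) * lDelta n (y + lUnit n) ^ (-γ) * 16 ^ (-|β|))
        (isOpen_lInterval n).measurableSet (lInterval_subset_lCone n) y fun x hx => ?_)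
      · rw [hv1, ← ENNReal.ofReal_mul (by positivity), ← ENNReal.ofReal_mul (by positivity)]
        congr 1
        ring
      · obtain ⟨b1, b2⟩ := lDelta_bounds hx
        have b3 := (rpow_bounds (t := lDelta n x) one_pos (by linarith) (by linarith) β).1
        rw [Real.one_rpow, mul_one] at b3
        exact mul_le_mul (lDelta_add_rpow_ge hx hy _) b3 (by positivity)
          (Real.rpow_nonneg (add_mem_lCone hy (lInterval_subset_lCone n hx)).1.le _)
    refine le_trans (le_of_eq ?_) (mul_le_mul_left (ENNReal.rpow_le_rpow hSop hq.le) _)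
    rw [ENNReal.ofReal_rpow_of_pos (by positivity), ← ENNReal.ofReal_mul (by positivity),
      ← ENNReal.ofReal_mul (by positivity)]
    congr 1
    rw [Real.mul_rpow (x := lDelta n y ^ α) (by positivity) (by positivity),
      Real.mul_rpow (x := k) hkpos.le (by positivity), ← Real.rpow_mul h0.le, ← Real.rpow_mul h1.le,
      show q * α + μ - (n : ℝ) / 2 = α * q + (μ - (n : ℝ) / 2) by ring, Real.rpow_add h0,
      show -(q * γ) = -γ * q by ring]
    ring
  exact ENNReal.lt_top_of_mul_ne_top_right hle.ne (by simpa using Real.rpow_pos_of_pos hkpos q)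

lemma SBounded.lintegral_source_lt_top {n : ℕ} [NeZero n] {α β γ p ν q μ : ℝ} (hp : 1 < p)
    (hq : 0 < q) (hS : SBounded n α β γ p ν q μ) :
    ∫⁻ x in lCone n, ENNReal.ofReal (lDelta n x ^ (β + (β - ν + (n : ℝ) / 2) / (p - 1)) *
      lDelta n (x + lUnit n) ^ (-(γ + γ / (p - 1)))) < ⊤ := by
  obtain ⟨C, hC, hb⟩ := hS
  have hB := (isOpen_lInterval n).measurableSet
  set k : ℝ := 16 ^ (-|α|) * 16 ^ (-|-γ|) with hk
  have hkpos : 0 < k := by positivity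
  set D : ℝ≥0∞ := (ENNReal.ofReal (16 ^ (-|μ - (n : ℝ) / 2|)) * volume (lInterval n)) ^ (1 / q)
    with hD
  have hbase0 : ENNReal.ofReal (16 ^ (-|μ - (n : ℝ) / 2|)) * volume (lInterval n) ≠ 0 :=
    mul_ne_zero (by simpa using Real.rpow_pos_of_pos (by norm_num) _) (volume_lInterval_pos n).ne'
  have hbaset : ENNReal.ofReal (16 ^ (-|μ - (n : ℝ) / 2|)) * volume (lInterval n) ≠ ⊤ :=
    ENNReal.mul_ne_top ENNReal.ofReal_ne_top (volume_lInterval_lt_top n).ne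
  have hD0 : D ≠ 0 := by simp [hD, ENNReal.rpow_eq_zero_iff, hbase0, hbaset]
  have hk0 : ENNReal.ofReal k ≠ 0 := by simpa using hkpos
  have hkD : ENNReal.ofReal k * D ≠ 0 := mul_ne_zero hk0 hD0
  have hDt : D ≠ ⊤ := ENNReal.rpow_ne_top_of_nonneg (by positivity) hbaset
  have main := lintegral_lt_top_of_forall_le n hp
    (w := fun x => lDelta n (x + lUnit n) ^ (-γ) * lDelta n x ^ β)
    (ρ := fun x => lDelta n x ^ (ν - (n : ℝ) / 2)) (by fun_prop) (by fun_prop)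
    (fun x hx => mul_pos (Real.rpow_pos_of_pos (lDelta_add_lUnit_pos hx) _)
      (Real.rpow_pos_of_pos hx.1 _)) (fun x hx => Real.rpow_pos_of_pos hx.1 _)
    (C := ENNReal.ofReal C / (ENNReal.ofReal k * D)) (ENNReal.div_lt_top ENNReal.ofReal_ne_top hkD)
    (fun g hg hfin => ?_)
  · refine lt_of_le_of_lt (setLIntegral_mono' (isOpen_lCone n).measurableSet fun x hx => ?_) main
    refine le_of_eq (congrArg _ ?_)
    have h0 := hx.1
    have h1 := lDelta_add_lUnit_pos hx
    rw [mul_div_assoc, ← Real.rpow_sub h0, Real.mul_rpow (by positivity) (by positivity),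
      ← Real.rpow_mul h0.le, ← Real.rpow_mul h1.le, neg_add, Real.rpow_add h0, Real.rpow_add h1,
      show (β - (ν - (n : ℝ) / 2)) * (1 / (p - 1)) = (β - ν + (n : ℝ) / 2) / (p - 1) by ring,
      show -γ * (1 / (p - 1)) = -(γ / (p - 1)) by ring]
    ring
  · set J := ∫⁻ x in lCone n, ENNReal.ofReal
      (lDelta n (x + lUnit n) ^ (-γ) * lDelta n x ^ β * |g x|) with hJ
    have hcn : coneNorm n p ν g < ⊤ := ENNReal.rpow_lt_top_of_nonneg (by positivity) hfin.ne
    have h1 := hb g hg hcn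
    have hSop : ∀ y ∈ lInterval n, ENNReal.ofReal k * J ≤ Sop n α β γ g y := by
      intro y hy
      rw [hk, ENNReal.ofReal_mul (by positivity), mul_assoc, Sop]
      refine mul_le_mul' (ENNReal.ofReal_le_ofReal ?_) ?_
      · obtain ⟨b1, b2⟩ := lDelta_bounds hy
        simpa using (rpow_bounds (t := lDelta n y) one_pos (by linarith) (by linarith) α).1
      · rw [hJ, ← lintegral_const_mul' _ _ ENNReal.ofReal_ne_top]
        refine setLIntegral_mono' (isOpen_lCone n).measurableSet fun x hx => ?_
        rw [← ENNReal.ofReal_mul (by positivity)]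
        refine ENNReal.ofReal_le_ofReal ?_
        have h2 := lDelta_add_rpow_ge hy hx (-γ)
        have h3 := Real.rpow_nonneg hx.1.le β
        rw [add_comm y x]
        calc 16 ^ (-|-γ|) * (lDelta n (x + lUnit n) ^ (-γ) * lDelta n x ^ β * |g x|)
            = 16 ^ (-|-γ|) * lDelta n (x + lUnit n) ^ (-γ) * |g x| * lDelta n x ^ β := by ring
          _ ≤ _ := by gcongr
    have h2 := (mul_rpow_le_SopNorm (μ := μ) hq hB (lInterval_subset_lCone n) hSop
      (d := 16 ^ (-|μ - (n : ℝ) / 2|)) fun y hy => ?_).trans h1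
    · change J ≤ ENNReal.ofReal C / (ENNReal.ofReal k * D) * coneNorm n p ν g
      rw [← ENNReal.mul_div_right_comm, ENNReal.le_div_iff_mul_le (Or.inl hkD)
        (Or.inl (ENNReal.mul_ne_top ENNReal.ofReal_ne_top hDt))]
      refine le_trans (le_of_eq ?_) h2
      rw [← hD]
      ring
    · obtain ⟨b1, b2⟩ := lDelta_bounds hy
      simpa using (rpow_bounds (t := lDelta n y) one_pos (by linarith) (by linarith) _).1

/-- Lemma 4.4 of the paper on the rank-2 Lorentz cone (necessity). -/
theorem statement13 (n : ℕ) [NeZero n] (hn : 3 ≤ n) (α β γ ν μ p q : ℝ)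
    (hp : 1 < p) (hpq : p ≤ q)
    (h : ν / (p / (p - 1)) + μ / q > 0)
    (hS : SBounded n α β γ p ν q μ) :
    γ = α + β + (n : ℝ) / 2 - ν / p + μ / q ∧
      (p * (β - γ + (n : ℝ) - 1) - (n : ℝ) / 2 + 1 < ν ∧ ν < p * (β + 1) + (n : ℝ) / 2 - 1) ∧
      ((n : ℝ) / 2 - 1 - q * α < μ ∧ μ < q * (γ - α) - (n : ℝ) / 2 + 1) := by
  have hp0 : 0 < p := by linarith
  have hq : 0 < q := by linarith
  have hp1 : 0 < p - 1 := by linarith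
  have hn2 : 2 ≤ n := by omega
  have hsrc := hS.lintegral_source_lt_top hp hq
  have htgt := hS.lintegral_target_lt_top hp0 hq
  have s1 := neg_one_lt_of_lintegral_lt_top n hn2 hsrc
  have s2 := lt_sub_of_lintegral_lt_top n hn2 hsrc
  have t1 := neg_one_lt_of_lintegral_lt_top n hn2 htgt
  have t2 := lt_sub_of_lintegral_lt_top n hn2 htgt
  have s1' := mul_lt_mul_of_pos_right s1 hp1
  have s2' := mul_lt_mul_of_pos_right s2 hp1
  have e1 : (β + (β - ν + (n : ℝ) / 2) / (p - 1)) * (p - 1) = p * β - ν + n / 2 := by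
    field_simp
    ring
  have e2 : (γ + γ / (p - 1) - (β + (β - ν + (n : ℝ) / 2) / (p - 1))) * (p - 1) =
      p * γ - (p * β - ν + n / 2) := by
    field_simp
    ring
  rw [e1] at s1'
  rw [e2] at s2'
  exact ⟨hS.homogeneity hp0 hq, ⟨by linarith, by linarith⟩, by linarith, by linarith⟩
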